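/- arXiv:2208.03068 — 2 statements merged into one kernel-verified Lean document; each statement's English description precedes it below -/
import Mathlib

section
/- The only pairs (n_1, n_2) with 2 ≤ n_2 < n_1 ≤ 23 for which T_{n_1} − T_{n_2} = b^{m_1} − b^{m_2} for some integers b ≥ 2 and m_1 > m_2 ≥ 1 are exactly those with (n_1, n_2) ∈ {(4,3), (5,2), (6,2), (6,5), (7,4), (8,3), (8,7), (11,3), (12,4), (12,7), (15,11), (23,12)}. -/
/-- The values `T_0, ..., T_23` (with a dummy value at `0`). -/
def tribVal (n : ℕ) : ℕ :=
  [0, 1, 1, 2, 4, 7, 13, 24, 44, 81, 149, 274, 504, 927, 1705, 3136, 5768, 10609, 19513, 35890,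
    66012, 121415, 223317, 410744].getD n 0

/-- The pairs occurring in the theorem. -/
def pairList : List (ℕ × ℕ) :=
  [(4, 3), (5, 2), (6, 2), (6, 5), (7, 4), (8, 3), (8, 7),
    (11, 3), (12, 4), (12, 7), (15, 11), (23, 12)]

/-- The table of the pairs `(n, T_n)` for `2 ≤ n ≤ 23`. -/
def tribTable : List (ℕ × ℕ) :=
  [(2, 1), (3, 2), (4, 4), (5, 7), (6, 13), (7, 24), (8, 44), (9, 81), (10, 149), (11,
    274), (12, 504), (13, 927), (14, 1705), (15, 3136), (16, 5768), (17, 10609), (18,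
    19513), (19, 35890), (20, 66012), (21, 121415), (22, 223317), (23, 410744)]

theorem mem_tribTable : ∀ n < 24, 2 ≤ n → (n, tribVal n) ∈ tribTable := by
  decide +kernel

/-- `T_{n₁} + y = T_{n₂} + x` holds, among admissible indices, only for listed pairs.
The inner loop is only entered if `T_{n₁}` has the right size. -/
def pairOK (x y : ℕ) : Bool :=
  tribTable.all fun p =>
    (Nat.ble (Nat.add p.2 y) x ||
        Nat.ble (Nat.mul 3 x) (Nat.add p.2 (Nat.sub (Nat.mul 3 y) 1))) ||
      tribTable.all fun q =>
        !(Nat.beq (Nat.add p.2 y) (Nat.add q.2 x)) || pairList.contains (p.1, q.1)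

/-- All exponents for a fixed base. -/
def baseOK (b : ℕ) : Bool :=
  (List.range 21).all fun m₁ => Nat.ble 821489 (Nat.pow b m₁) ||
    (List.range m₁).all fun m₂ => Nat.ble m₂ 0 || pairOK (Nat.pow b m₁) (Nat.pow b m₂)

theorem search_bool : ((List.range 643).all fun b => Nat.ble b 1 || baseOK b) = true := by
  decide +kernel

theorem tribVal_gap : ∀ n₁ < 24, ∀ n₂ < n₁, 2 ≤ n₂ →
    1 ≤ tribVal n₂ ∧ 3 * tribVal n₂ ≤ 2 * tribVal n₁ := by
  decide +kernel

/-- The exhaustive search: base `b`, exponents `m₁ > m₂`, and the index pair. -/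
theorem search : ∀ b < 643, 2 ≤ b → ∀ m₁ < 21, b ^ m₁ ≤ 2 * 410744 → ∀ m₂ < m₁, 1 ≤ m₂ →
    ∀ n₁ < 24, ∀ n₂ < n₁, 2 ≤ n₂ → tribVal n₁ + b ^ m₂ = tribVal n₂ + b ^ m₁ →
      (n₁, n₂) ∈ pairList := by
  intro b hb hb2 m₁ hm₁ hle m₂ hm₂ hm₂' n₁ hn₁ n₂ hn₂ hn₂' h
  have h1 := List.all_eq_true.mp search_bool b (List.mem_range.mpr hb)
  have e1 : Nat.ble b 1 = false := by
    rw [← Bool.not_eq_true, Nat.ble_eq]; omega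
  rw [e1, Bool.false_or] at h1
  have h2 := List.all_eq_true.mp h1 m₁ (List.mem_range.mpr hm₁)
  have e2 : Nat.ble 821489 (Nat.pow b m₁) = false := by
    rw [← Bool.not_eq_true, Nat.ble_eq]
    change ¬ 821489 ≤ b ^ m₁
    omega
  rw [e2, Bool.false_or] at h2
  have h3 := List.all_eq_true.mp h2 m₂ (List.mem_range.mpr hm₂)
  have e3 : Nat.ble m₂ 0 = false := by
    rw [← Bool.not_eq_true, Nat.ble_eq]; omega
  rw [e3, Bool.false_or] at h3
  obtain ⟨g1, g2⟩ := tribVal_gap n₁ hn₁ n₂ hn₂ hn₂'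
  have h4 := List.all_eq_true.mp h3 (n₁, tribVal n₁) (mem_tribTable n₁ hn₁ (by omega))
  have e4 : Nat.ble (Nat.add (tribVal n₁) (Nat.pow b m₂)) (Nat.pow b m₁) = false := by
    rw [← Bool.not_eq_true, Nat.ble_eq]
    change ¬ tribVal n₁ + b ^ m₂ ≤ b ^ m₁
    omega
  have hpos : 0 < b ^ m₂ := Nat.pow_pos (by omega)
  have e5 : Nat.ble (Nat.mul 3 (Nat.pow b m₁))
      (Nat.add (tribVal n₁) (Nat.sub (Nat.mul 3 (Nat.pow b m₂)) 1)) = false := by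
    rw [← Bool.not_eq_true, Nat.ble_eq]
    change ¬ 3 * b ^ m₁ ≤ tribVal n₁ + (3 * b ^ m₂ - 1)
    omega
  rw [e4, e5, Bool.false_or, Bool.false_or] at h4
  have h5 := List.all_eq_true.mp h4 (n₂, tribVal n₂) (mem_tribTable n₂ (by omega) hn₂')
  have e6 : Nat.beq (Nat.add (tribVal n₁) (Nat.pow b m₂))
      (Nat.add (tribVal n₂) (Nat.pow b m₁)) = true :=
    Nat.beq_eq.mpr h
  rw [e6, Bool.not_true, Bool.false_or] at h5
  exact List.contains_iff_mem.mp h5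

theorem tribVal_le : ∀ n < 24, tribVal n ≤ 410744 := by decide +kernel

theorem tribonacci_small_solutions (T : ℕ → ℤ)
    (hT1 : T 1 = 1) (hT2 : T 2 = 1) (hT3 : T 3 = 2)
    (hTrec : ∀ n, 4 ≤ n → T n = T (n - 1) + T (n - 2) + T (n - 3)) :
    ∀ n₁ n₂ : ℕ, 2 ≤ n₂ → n₂ < n₁ → n₁ ≤ 23 →
      ((∃ (b : ℤ) (m₁ m₂ : ℕ), 2 ≤ b ∧ 1 ≤ m₂ ∧ m₂ < m₁ ∧
          T n₁ - T n₂ = b ^ m₁ - b ^ m₂) ↔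
        (n₁, n₂) ∈ ({(4, 3), (5, 2), (6, 2), (6, 5), (7, 4), (8, 3), (8, 7),
          (11, 3), (12, 4), (12, 7), (15, 11), (23, 12)} : Set (ℕ × ℕ))) := by
  have hT : ∀ n, 1 ≤ n → n < 24 → T n = (tribVal n : ℤ) := by
    intro n
    induction n using Nat.strong_induction_on with
    | _ n ih =>
      intro h1 h2
      by_cases h4 : 4 ≤ n
      · rw [hTrec n h4, ih (n - 1) (by omega) (by omega) (by omega),
          ih (n - 2) (by omega) (by omega) (by omega), ih (n - 3) (by omega) (by omega) (by omega)]
        clear ih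
        interval_cases n <;> simp [tribVal]
      · clear ih
        interval_cases n <;> simp [tribVal, hT1, hT2, hT3]
  intro n₁ n₂ h2 h21 h1
  rw [hT n₁ (by omega) (by omega), hT n₂ (by omega) (by omega)]
  constructor
  · rintro ⟨b, m₁, m₂, hb, hm2, hm, h⟩
    lift b to ℕ using by omega
    have hb : 2 ≤ b := by exact_mod_cast hb
    have h : tribVal n₁ + b ^ m₂ = tribVal n₂ + b ^ m₁ := by
      zify
      linarith
    have hle := tribVal_le n₁ (by omega)
    obtain ⟨k, rfl⟩ : ∃ k, m₁ = k + 1 := ⟨m₁ - 1, by omega⟩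
    have hk : b ^ m₂ ≤ b ^ k := Nat.pow_le_pow_right (by omega) (by omega)
    have hbk : b ≤ b ^ k := Nat.le_self_pow (by omega) b
    have h2k : 2 ^ k ≤ b ^ k := Nat.pow_le_pow_left hb k
    rw [pow_succ] at h
    obtain ⟨c, rfl⟩ : ∃ c, b = c + 1 := ⟨b - 1, by omega⟩
    have hc : (c + 1) ^ k * c ≤ 410744 := by nlinarith
    have hc1 : (c + 1) ^ k ≤ 410744 := by nlinarith
    have hk20 : k < 20 := by
      by_contra hcon
      have : 2 ^ 20 ≤ 2 ^ k := Nat.pow_le_pow_right (by norm_num) (by omega)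
      omega
    have hb643 : c + 1 < 643 := by
      by_contra hcon
      have : 643 * 642 ≤ (c + 1) ^ k * c := Nat.mul_le_mul (by omega) (by omega)
      omega
    have := search (c + 1) hb643 hb (k + 1) (by omega) (by rw [pow_succ]; nlinarith) m₂ hm hm2
      n₁ (by omega) n₂ h21 h2 (by rw [pow_succ]; exact h)
    simpa [pairList] using this
  · intro h
    simp only [Set.mem_insert_iff, Set.mem_singleton_iff, Prod.mk.injEq] at h
    rcases h with ⟨rfl, rfl⟩ | ⟨rfl, rfl⟩ | ⟨rfl, rfl⟩ | ⟨rfl, rfl⟩ | ⟨rfl, rfl⟩ | ⟨rfl, rfl⟩ |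
      ⟨rfl, rfl⟩ | ⟨rfl, rfl⟩ | ⟨rfl, rfl⟩ | ⟨rfl, rfl⟩ | ⟨rfl, rfl⟩ | ⟨rfl, rfl⟩
    · exact ⟨2, 2, 1, by norm_num [tribVal]⟩
    · exact ⟨2, 3, 1, by norm_num [tribVal]⟩
    · exact ⟨2, 4, 2, by norm_num [tribVal]⟩
    · exact ⟨2, 3, 1, by norm_num [tribVal]⟩
    · exact ⟨5, 2, 1, by norm_num [tribVal]⟩
    · exact ⟨7, 2, 1, by norm_num [tribVal]⟩
    · exact ⟨5, 2, 1, by norm_num [tribVal]⟩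
    · exact ⟨17, 2, 1, by norm_num [tribVal]⟩
    · exact ⟨5, 4, 3, by norm_num [tribVal]⟩
    · exact ⟨2, 9, 5, by norm_num [tribVal]⟩
    · exact ⟨54, 2, 1, by norm_num [tribVal]⟩
    · exact ⟨641, 2, 1, by norm_num [tribVal]⟩
end

section
/- There is no integer c having three representations c = T_{n_i} − b^{m_i} (i = 1,2,3) with a fixed integer b ≥ 2, where 2 ≤ n_3 < n_2 < n_1 ≤ 150 and m_1 > m_2 > m_3 ≥ 1, and T_n is the Tribonacci sequence. -/
namespace TribAux

/-- The triple `(T (n+1), T (n+2), T (n+3))`. -/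
def tp : ℕ → ℕ × ℕ × ℕ
  | 0 => (1, 1, 2)
  | n + 1 => ((tp n).2.1, (tp n).2.2, (tp n).1 + (tp n).2.1 + (tp n).2.2)

def t (n : ℕ) : ℕ := (tp (n - 1)).1

/-- The values `T 2, ..., T 150`. -/
def table : List ℕ :=
  [
   1, 2, 4, 7, 13, 24, 44, 81, 149, 274, 504, 927, 1705, 3136, 5768, 10609, 19513, 35890, 66012,
   121415, 223317, 410744, 755476, 1389537, 2555757, 4700770, 8646064, 15902591, 29249425,
   53798080, 98950096, 181997601, 334745777, 615693474, 1132436852, 2082876103, 3831006429,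
   7046319384, 12960201916, 23837527729, 43844049029, 80641778674, 148323355432, 272809183135,
   501774317241, 922906855808, 1697490356184, 3122171529233, 5742568741225, 10562230626642,
   19426970897100, 35731770264967, 65720971788709, 120879712950776, 222332455004452,
   408933139743937, 752145307699165, 1383410902447554, 2544489349890656, 4680045560037375,
   8607945812375585, 15832480722303616, 29120472094716576, 53560898629395777, 98513851446415969,
   181195222170528322, 333269972246340068, 612979045863284359, 1127444240280152749,
   2073693258389777176, 3814116544533214284, 7015254043203144209, 12903063846126135669,
   23732434433862494162, 43650752323191774040, 80286250603180403871, 147669437360234672073,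
   271606440286606849984, 499562128250021925928, 918838005896863447985, 1690006574433492223897,
   3108406708580377597810, 5717251288910733269692, 10515664571924603091399,
   19341322569415713958901, 35574238430251050319992, 65431225571591367370292,
   120346786571258131649185, 221352250573100549339469, 407130262715950048358946,
   748829299860308729347600, 1377311813149359327046015, 2533271375725618104752561,
   4659412488735286161146176, 8569995677610263592944752, 15762679542071167858843489,
   28992087708416717612934417, 53324762928098149064722658, 98079530178586034536500564,
   180396380815100901214157639, 331800673921785084815380861, 610276584915472020566039064,
   1122473639652358006595577564, 2064550898489615111976997489, 3797301123057445139138614117,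
   6984325661199418257711189170, 12846177682746478508826800776, 23627804467003341905676604063,
   43458307810949238672214594009, 79932289960699059086717998848, 147018402238651639664609196920,
   270409000010299937423541789777, 497359692209650636174868985545,
   914787094458602213263019972242, 1682555786678552786861430747564,
   3094702573346805636299319705351, 5692045454483960636423770425157,
   10469303814509319059584520878072, 19256051842340085332307611008580,
   35417401111333365028315902311809, 65142756768182769420208034198461,
   119816209721856219780831547518850, 220376367601372354229355484029120,
   405335334091411343430395065746431, 745527911414639917440582097294401,
   1371239613107423615100332647069952, 2522102858613474875971309810110784,
   4638870383135538408512224554475137, 8532212854856436899583867011655873,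
   15693186096605450184067401376241794, 28864269334597425492163492942372804,
   53089668286059312575814761330270471, 97647123717262188252045655648885069,
   179601061337918926320023909921528344, 330337853341240427147884326900683884,
   607586038396421541719953892471097297, 1117524953075580895187862129293309525,
   2055448844813242864055700348665090706, 3780559836285245300963516370429497528,
   6953533634174069060207078848387897759, 12789542315272557225226295567482485993,
   23523635785731871586396890786299881280, 43266711735178497871830265202170265032,
   79579889836182926683453451555952632305, 146370237357093296141680607544422778617,
   269216838928454720696964324302545675954, 495166966121730943522098383402921086876,
   910754042407278960360743315249889541447, 1675137847457464624579806022955356304277]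

/-- Inner loop, over the largest element, when the middle element is large. -/
def innerA (y d : ℕ) : List ℕ → Bool
  | [] => true
  | x :: xs =>
    (Nat.beq ((x - y) % 2) 1 || Nat.ble (Nat.gcd (x - y) (Nat.gcd (x - y) d ^ 150)) d)
      && innerA y d xs

/-- Inner test when the middle element is small. -/
def innerB (y d : ℕ) (xs : List ℕ) : Bool :=
  (List.range 474).all fun b =>
    Nat.ble b 1 || !(Nat.beq (d % b) 0) || (List.range 19).all fun m =>
      Nat.ble m 1 || Nat.ble (b ^ m) d || !(Nat.ble (b ^ (m - 1)) d) ||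
        ((List.range m).all fun k => !(Nat.beq (d + b ^ k) (b ^ m))) ||
        xs.all fun x => !(Nat.beq (b ^ 150 % (x - y + b ^ m)) 0)

def middle (z : ℕ) : List ℕ → Bool
  | [] => true
  | y :: ys =>
    (Nat.beq ((y - z) % 2) 1 ||
      (bif Nat.ble y 223317 then innerB y (y - z) ys else innerA y (y - z) ys)) && middle z ys

def outer : List ℕ → Bool
  | [] => true
  | z :: zs => middle z zs && outer zs

theorem table_eq : (List.range' 2 149).map t = table := by decide +kernel

theorem outer_table : outer table = true := by decide +kernel

theorem innerA_spec (y d : ℕ) : ∀ l : List ℕ, innerA y d l = true → ∀ x ∈ l,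
    (x - y) % 2 = 1 ∨ Nat.gcd (x - y) (Nat.gcd (x - y) d ^ 150) ≤ d := by
  intro l
  induction l with
  | nil => simp
  | cons a l ih =>
    intro h x hx
    rw [innerA, Bool.and_eq_true, Bool.or_eq_true, Nat.beq_eq, Nat.ble_eq] at h
    rcases List.mem_cons.1 hx with rfl | hx
    · exact h.1
    · exact ih h.2 x hx

theorem innerB_spec (y d : ℕ) (xs : List ℕ) (h : innerB y d xs = true) (b m k x : ℕ)
    (hb : 2 ≤ b) (hb' : b < 474) (hd : b ∣ d) (hm : 2 ≤ m) (hm' : m < 19) (h1 : d < b ^ m)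
    (h2 : b ^ (m - 1) ≤ d) (hk : k < m) (hkm : d + b ^ k = b ^ m) (hx : x ∈ xs)
    (hdvd : x - y + b ^ m ∣ b ^ 150) : False := by
  rw [innerB, List.all_eq_true] at h
  have h3 := h b (List.mem_range.2 hb')
  have e1 : Nat.ble b 1 = false := by
    rw [← Bool.not_eq_true, Nat.ble_eq]; omega
  have e2 : Nat.beq (d % b) 0 = true := by
    rw [Nat.beq_eq]; exact Nat.mod_eq_zero_of_dvd hd
  rw [e1, e2] at h3
  simp only [Bool.not_true, Bool.or_false, Bool.false_or] at h3
  rw [List.all_eq_true] at h3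
  have h4 := h3 m (List.mem_range.2 hm')
  have e3 : Nat.ble m 1 = false := by
    rw [← Bool.not_eq_true, Nat.ble_eq]; omega
  have e4 : Nat.ble (b ^ m) d = false := by
    rw [← Bool.not_eq_true, Nat.ble_eq]; omega
  have e5 : Nat.ble (b ^ (m - 1)) d = true := by
    rw [Nat.ble_eq]; exact h2
  rw [e3, e4, e5] at h4
  simp only [Bool.not_true, Bool.or_false, Bool.false_or] at h4
  rw [Bool.or_eq_true, List.all_eq_true, List.all_eq_true] at h4
  rcases h4 with h4 | h4
  · have h5 := h4 k (List.mem_range.2 hk)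
    have e6 : Nat.beq (d + b ^ k) (b ^ m) = true := by
      rw [Nat.beq_eq]; exact hkm
    rw [e6] at h5
    simp at h5
  · have h5 := h4 x hx
    have e6 : Nat.beq (b ^ 150 % (x - y + b ^ m)) 0 = true := by
      rw [Nat.beq_eq]; exact Nat.mod_eq_zero_of_dvd hdvd
    rw [e6] at h5
    simp at h5

/-- What the tests say about a triple. -/
theorem middle_spec (z : ℕ) : ∀ l : List ℕ, middle z l = true → ∀ y x,
    List.Sublist [y, x] l → (y - z) % 2 = 1 ∨
      (y ≤ 223317 ∧ ∃ xs, x ∈ xs ∧ innerB y (y - z) xs = true) ∨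
      (∃ xs, x ∈ xs ∧ innerA y (y - z) xs = true) := by
  intro l
  induction l with
  | nil => intro _ y x h; simp at h
  | cons a l ih =>
    intro h y x hs
    rw [middle, Bool.and_eq_true, Bool.or_eq_true, Nat.beq_eq] at h
    cases hs with
    | cons _ hs => exact ih h.2 y x hs
    | cons_cons _ hs =>
      have hx : x ∈ l := List.singleton_sublist.1 hs
      rcases h.1 with h1 | h1
      · exact Or.inl h1
      · right
        cases hc : Nat.ble a 223317 with
        | true =>
          rw [hc, cond_true] at h1
          exact Or.inl ⟨Nat.le_of_ble_eq_true hc, l, hx, h1⟩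
        | false =>
          rw [hc, cond_false] at h1
          exact Or.inr ⟨l, hx, h1⟩

theorem outer_spec : ∀ l : List ℕ, outer l = true → ∀ z y x,
    List.Sublist [z, y, x] l → ∃ l', middle z l' = true ∧ List.Sublist [y, x] l' := by
  intro l
  induction l with
  | nil => intro _ z y x h; simp at h
  | cons a l ih =>
    intro h z y x hs
    rw [outer, Bool.and_eq_true] at h
    cases hs with
    | cons _ hs => exact ih h.2 z y x hs
    | cons_cons _ hs => exact ⟨l, h.1, hs⟩

theorem sublist_table (n₁ n₂ n₃ : ℕ) (h3 : 2 ≤ n₃) (h32 : n₃ < n₂) (h21 : n₂ < n₁)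
    (h1 : n₁ ≤ 150) : List.Sublist [t n₃, t n₂, t n₁] table := by
  rw [← table_eq]
  have : List.Sublist [n₃, n₂, n₁] (List.range' 2 149) := by
    have e : List.range' 2 149 = List.range' 2 (n₃ - 2) ++ (n₃ :: (List.range' (n₃ + 1) (n₂ - n₃ - 1)
        ++ (n₂ :: (List.range' (n₂ + 1) (n₁ - n₂ - 1) ++ (n₁ :: List.range' (n₁ + 1) (150 - n₁)))))) := by
      obtain ⟨k, rfl⟩ : ∃ k, n₁ = n₂ + 1 + k := ⟨n₁ - n₂ - 1, by omega⟩
      obtain ⟨i, rfl⟩ : ∃ i, n₂ = n₃ + 1 + i := ⟨n₂ - n₃ - 1, by omega⟩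
      obtain ⟨j, rfl⟩ : ∃ j, n₃ = 2 + j := ⟨n₃ - 2, by omega⟩
      rw [← List.range'_succ, show 2 + j + 1 + i + 1 + k - (2 + j + 1 + i) - 1 = k by omega,
        List.range'_append_1, ← List.range'_succ, show 2 + j + 1 + i - (2 + j) - 1 = i by omega,
        List.range'_append_1, ← List.range'_succ, show 2 + j - 2 = j by omega,
        List.range'_append_1]
      congr 1
      omega
    rw [e]
    refine List.Sublist.trans ?_ (List.sublist_append_right _ _)
    refine List.Sublist.cons_cons _ (List.Sublist.trans ?_ (List.sublist_append_right _ _))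
    refine List.Sublist.cons_cons _ (List.Sublist.trans ?_ (List.sublist_append_right _ _))
    exact List.Sublist.cons_cons _ (List.nil_sublist _)
  exact this.map t

/-- Elementary consequences of `D + b ^ u = b ^ v`. -/
theorem power_facts (D b u v : ℕ) (hb : 2 ≤ b) (hu : 1 ≤ u) (huv : u < v)
    (h : D + b ^ u = b ^ v) :
    b ^ u ∣ D ∧ b ∣ D ∧ D % 2 = 0 ∧ b ^ (v - 1) ≤ D ∧ D < b ^ v ∧ b ^ (v - 1) * (b - 1) ≤ D := by
  have hpos : 0 < b ^ u := by positivity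
  have hdv : b ^ u ∣ D := by
    have h1 : b ^ u ∣ D + b ^ u := h ▸ pow_dvd_pow b huv.le
    exact (Nat.dvd_add_left (dvd_refl _)).1 h1
  have hkey : b ^ (v - 1) * (b - 1) ≤ D := by
    have h1 : b ^ u ≤ b ^ (v - 1) := Nat.pow_le_pow_right (by omega) (by omega)
    have h2 : b ^ v = b ^ (v - 1) * b := by
      rw [← pow_succ]; congr 1; omega
    have h3 : b ^ (v - 1) * b = b ^ (v - 1) * (b - 1) + b ^ (v - 1) := by
      obtain ⟨c, rfl⟩ : ∃ c, b = c + 1 := ⟨b - 1, by omega⟩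
      simp only [Nat.add_sub_cancel]; ring
    omega
  refine ⟨hdv, (dvd_pow_self b (by omega)).trans hdv, ?_, ?_, by omega, hkey⟩
  · have e : (b ^ u) % 2 = (b ^ v) % 2 := by
      rcases Nat.even_or_odd b with hb2 | hb2
      · rw [Nat.even_iff.1 (hb2.pow_of_ne_zero (by omega)),
          Nat.even_iff.1 (hb2.pow_of_ne_zero (by omega))]
      · rw [Nat.odd_iff.1 hb2.pow, Nat.odd_iff.1 hb2.pow]
    omega
  · exact (Nat.le_mul_of_pos_right _ (by omega)).trans hkey

theorem exp_bound (D b v N : ℕ) (hb : 2 ≤ b) (h : b ^ (v - 1) ≤ D) (hD : D < 2 ^ N) : v ≤ N := by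
  have h1 : 2 ^ (v - 1) < 2 ^ N := ((Nat.pow_le_pow_left hb _).trans h).trans_lt hD
  have := (Nat.pow_lt_pow_iff_right (by norm_num : 1 < 2)).1 h1
  omega

theorem table_bound : ∀ x ∈ table, x < 2 ^ 150 := by decide +kernel

theorem nat_version (b n₁ n₂ n₃ m₁ m₂ m₃ : ℕ) (hb : 2 ≤ b) (h3 : 2 ≤ n₃) (h32 : n₃ < n₂)
    (h21 : n₂ < n₁) (h1 : n₁ ≤ 150) (hm3 : 1 ≤ m₃) (hm32 : m₃ < m₂) (hm21 : m₂ < m₁)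
    (e1 : t n₁ + b ^ m₂ = t n₂ + b ^ m₁) (e2 : t n₂ + b ^ m₃ = t n₃ + b ^ m₂) : False := by
  have hs := sublist_table n₁ n₂ n₃ h3 h32 h21 h1
  have bx := table_bound (t n₁) (hs.subset (by simp))
  have bY := table_bound (t n₂) (hs.subset (by simp))
  obtain ⟨l', hl, hs'⟩ := outer_spec _ outer_table _ _ _ hs
  have hmid := middle_spec _ _ hl _ _ hs'
  generalize t n₁ = x at *
  generalize t n₂ = y at *
  generalize t n₃ = z at *
  have p12 : b ^ m₂ < b ^ m₁ := Nat.pow_lt_pow_right (by omega) hm21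
  have p23 : b ^ m₃ < b ^ m₂ := Nat.pow_lt_pow_right (by omega) hm32
  obtain ⟨f1, f2, f3, f4, f5, f6⟩ :=
    power_facts (x - y) b m₂ m₁ hb (by omega) hm21 (by omega)
  obtain ⟨g1, g2, g3, g4, g5, g6⟩ :=
    power_facts (y - z) b m₃ m₂ hb hm3 hm32 (by omega)
  rcases hmid with h | ⟨hy, xs, hx, h⟩ | ⟨xs, hx, h⟩
  · omega
  · have hm2 : m₂ ≤ 18 := exp_bound _ _ _ _ hb g4 (by norm_num; omega)
    have hm1 : m₁ ≤ 150 := exp_bound _ _ _ _ hb f4 (by omega)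
    have hb' : b < 474 := by
      by_contra hcon
      have a1 : b ≤ b ^ (m₂ - 1) := Nat.le_self_pow (by omega) b
      have a2 : 474 * 473 ≤ b ^ (m₂ - 1) * (b - 1) := Nat.mul_le_mul (by omega) (by omega)
      omega
    refine innerB_spec _ _ _ h b m₂ m₃ x hb hb' g2 (by omega) (by omega) g5 g4 hm32 (by omega) hx ?_
    rw [show x - y + b ^ m₂ = b ^ m₁ by omega]
    exact pow_dvd_pow b hm1
  · have hm2 : m₂ ≤ 150 := exp_bound _ _ _ _ hb g4 (by omega)
    rcases innerA_spec _ _ _ h x hx with h | h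
    · omega
    · have d1 : b ^ m₂ ∣ Nat.gcd (x - y) (Nat.gcd (x - y) (y - z) ^ 150) :=
        Nat.dvd_gcd f1 ((pow_dvd_pow b hm2).trans (pow_dvd_pow_of_dvd (Nat.dvd_gcd f2 g2) 150))
      have d2 := Nat.le_of_dvd (Nat.gcd_pos_of_pos_left _ (by omega)) d1
      omega

end TribAux

theorem tribonacci_no_three_small_solutions (T : ℕ → ℤ)
    (hT1 : T 1 = 1) (hT2 : T 2 = 1) (hT3 : T 3 = 2)
    (hTrec : ∀ n, 4 ≤ n → T n = T (n - 1) + T (n - 2) + T (n - 3)) :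
    ¬ ∃ (b c : ℤ) (n₁ n₂ n₃ m₁ m₂ m₃ : ℕ),
      2 ≤ b ∧ 2 ≤ n₃ ∧ n₃ < n₂ ∧ n₂ < n₁ ∧ n₁ ≤ 150 ∧
      1 ≤ m₃ ∧ m₃ < m₂ ∧ m₂ < m₁ ∧
      T n₁ - b ^ m₁ = c ∧ T n₂ - b ^ m₂ = c ∧ T n₃ - b ^ m₃ = c := by
  have hrec : ∀ n, T (n + 4) = T (n + 3) + T (n + 2) + T (n + 1) := fun n => hTrec (n + 4) (by omega)
  have htp : ∀ n, T (n + 1) = ((TribAux.tp n).1 : ℤ) ∧ T (n + 2) = ((TribAux.tp n).2.1 : ℤ) ∧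
      T (n + 3) = ((TribAux.tp n).2.2 : ℤ) := by
    intro n
    induction n with
    | zero => simp [TribAux.tp, hT1, hT2, hT3]
    | succ n ih =>
      obtain ⟨i1, i2, i3⟩ := ih
      refine ⟨i2, i3, ?_⟩
      rw [show n + 1 + 3 = n + 4 by omega, hrec, i1, i2, i3, TribAux.tp]
      push_cast
      ring
  have ht : ∀ n, 1 ≤ n → T n = (TribAux.t n : ℤ) := by
    intro n hn
    obtain ⟨k, rfl⟩ : ∃ k, n = k + 1 := ⟨n - 1, by omega⟩
    exact (htp k).1
  rintro ⟨b, c, n₁, n₂, n₃, m₁, m₂, m₃, hb, h3, h32, h21, h1, hm3, hm32, hm21, e1, e2, e3⟩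
  lift b to ℕ using by omega
  rw [ht _ (by omega)] at e1 e2 e3
  refine TribAux.nat_version b n₁ n₂ n₃ m₁ m₂ m₃ (by exact_mod_cast hb) h3 h32 h21 h1 hm3 hm32 hm21
    ?_ ?_
  · zify; linarith
  · zify; linarith
end
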